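/- arXiv:2505.11259 — 2 statements merged into one kernel-verified Lean document; each statement's English description precedes it below -/
import Mathlib

section
/- For every polytope P with at least two vertices, the pyramidal width equals the affine pyramidal width: δ(P) = δ̄(P). -/
section Defs

variable {E : Type*} [NormedAddCommGroup E] [InnerProductSpace ℝ E]

/-- The (Euclidean) distance between two sets. -/
noncomputable def setDist {X : Type*} [PseudoMetricSpace X] (A B : Set X) : ℝ :=
  sInf ((fun p : X × X => dist p.1 p.2) '' (A ×ˢ B))

/-- A polytope: the convex hull of a nonempty finite set of points. -/
def IsPolytope (S : Set E) : Prop :=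
  ∃ V : Set E, V.Finite ∧ V.Nonempty ∧ S = convexHull ℝ V

/-- A face of `P`: a nonempty proper exposed face. -/
def IsFaceOf (P f : Set E) : Prop :=
  IsExposed ℝ P f ∧ f.Nonempty ∧ f ≠ P

/-- `P^f = conv(V(P) \ V(f))`, where `V(·)` denotes the set of extreme points. -/
noncomputable def compPoly (P f : Set E) : Set E :=
  convexHull ℝ (P.extremePoints ℝ \ f.extremePoints ℝ)

/-- The pyramidal width `δ(P) = min over faces f of dist(f, P^f)`. -/
noncomputable def pyramidalWidth (P : Set E) : ℝ :=
  sInf {d : ℝ | ∃ f : Set E, IsFaceOf P f ∧ d = setDist f (compPoly P f)}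

/-- The affine pyramidal width `δ̄(P) = min over faces f of dist(aff(f), P^f)`. -/
noncomputable def affPyramidalWidth (P : Set E) : ℝ :=
  sInf {d : ℝ | ∃ f : Set E, IsFaceOf P f ∧ d = setDist (affineSpan ℝ f : Set E) (compPoly P f)}

end Defs

section Faces

variable {E : Type*} [NormedAddCommGroup E]

/-- The distance between two sets is at most the distance between any of their points. -/
lemma setDist_le_dist {X : Type*} [PseudoMetricSpace X] {A B : Set X} {a b : X}
    (ha : a ∈ A) (hb : b ∈ B) : setDist A B ≤ dist a b :=
  csInf_le ⟨0, by rintro _ ⟨p, -, rfl⟩; exact dist_nonneg⟩ ⟨(a, b), ⟨ha, hb⟩, rfl⟩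

lemma le_setDist {X : Type*} [PseudoMetricSpace X] {A B : Set X} {r : ℝ}
    (hA : A.Nonempty) (hB : B.Nonempty) (h : ∀ a ∈ A, ∀ b ∈ B, r ≤ dist a b) :
    r ≤ setDist A B := by
  refine le_csInf ((hA.prod hB).image _) ?_
  rintro _ ⟨⟨a, b⟩, ⟨ha, hb⟩, rfl⟩
  exact h a ha b hb

/-- The ray from a suitable point `w` of a closed convex set `f` to a point `x` of its affine span
outside `f` leaves `f` at a point `z` that has a supporting functional not maximal at `w`. -/
lemma exists_supporting_functional_of_mem_affineSpan [NormedSpace ℝ E] [FiniteDimensional ℝ E]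
    {f : Set E} (hconv : Convex ℝ f) (hclosed : IsClosed f) (hne : f.Nonempty) {x : E}
    (hx : x ∈ affineSpan ℝ f) (hxf : x ∉ f) :
    ∃ (l : StrongDual ℝ E) (z w : E), z ∈ f ∧ w ∈ f ∧ z ∈ segment ℝ w x ∧ (∀ v ∈ f, l v ≤ l z) ∧
      l w < l z := by
  obtain ⟨p, hp⟩ := hne
  set D : Set E := (fun v => v -ᵥ p) '' f
  have memD : ∀ v, v ∈ D ↔ v + p ∈ f := by
    intro v
    constructor
    · rintro ⟨u, hu, rfl⟩
      simpa using hu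
    · intro h
      exact ⟨v + p, h, by simp⟩
  set S : Submodule ℝ E := Submodule.span ℝ D
  set C : Set S := Subtype.val ⁻¹' D
  have memC : ∀ s : S, s ∈ C ↔ (s : E) + p ∈ f := fun s => memD s
  have hxS : x - p ∈ S := by
    have h := AffineSubspace.vsub_mem_direction hx (subset_affineSpan ℝ f hp)
    rwa [direction_affineSpan, vectorSpan_eq_span_vsub_set_right ℝ hp] at h
  have hCconv : Convex ℝ C := by
    intro s hs t ht a b ha hb hab
    rw [memC] at *
    have h := hconv hs ht ha hb hab
    convert h using 1
    have hb' : b = 1 - a := by linarith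
    subst hb'
    simp only [Submodule.coe_add, Submodule.coe_smul]
    module
  have hCclosed : IsClosed C := by
    have : C = (fun s : S => (s : E) + p) ⁻¹' f := by
      ext s
      exact memC s
    rw [this]
    exact hclosed.preimage (by fun_prop)
  have h0 : (0 : S) ∈ C := by
    rw [memC]
    simpa using hp
  have hspan : affineSpan ℝ C = ⊤ := by
    rw [AffineSubspace.affineSpan_eq_top_iff_vectorSpan_eq_top_of_nonempty ℝ S S ⟨0, h0⟩,
      vectorSpan_eq_span_vsub_set_right ℝ h0]
    have h : Submodule.span ℝ C = ⊤ := Submodule.span_span_coe_preimage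
    simpa using h
  obtain ⟨w, hw⟩ := hCconv.interior_nonempty_iff_affineSpan_eq_top.2 hspan
  obtain ⟨z, hzseg, hzC, hzint⟩ : ∃ z ∈ segment ℝ w ⟨x - p, hxS⟩, z ∈ C ∧ z ∉ interior C := by
    by_contra! hcon
    obtain ⟨y, -, hyint, hyC⟩ := (convex_segment (𝕜 := ℝ) w ⟨x - p, hxS⟩).isPreconnected
      (interior C) Cᶜ isOpen_interior hCclosed.isOpen_compl
      (fun y hy => (em (y ∈ C)).imp (hcon y hy) id)
      ⟨w, left_mem_segment .., hw⟩
      ⟨⟨x - p, hxS⟩, right_mem_segment .., fun h => hxf (by simpa using (memC _).1 h)⟩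
    exact hyC (interior_subset hyint)
  obtain ⟨l, hl⟩ := geometric_hahn_banach_open_point hCconv.interior isOpen_interior hzint
  have hlC : ∀ s ∈ C, l s ≤ l z := by
    intro s hs
    have hs' : s ∈ closure (interior C) := by
      rw [hCconv.closure_interior_eq_closure_of_nonempty_interior ⟨w, hw⟩]
      exact subset_closure hs
    exact closure_minimal (fun a ha => (hl a ha).le)
      (isClosed_le l.continuous continuous_const) hs'
  obtain ⟨L, hL, -⟩ := exists_extension_norm_eq S l
  refine ⟨L, z + p, w + p, (memC z).1 hzC,
    (memC w).1 (interior_subset hw), ?_, ?_, ?_⟩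
  · obtain ⟨a, b, ha, hb, hab, h⟩ := hzseg
    refine ⟨a, b, ha, hb, hab, ?_⟩
    rw [← h]
    have hb' : b = 1 - a := by linarith
    subst hb'
    simp only [Submodule.coe_add, Submodule.coe_smul]
    module
  · intro v hv
    have hvD : v - p ∈ D := (memD _).2 (by simpa using hv)
    have h := hlC ⟨v - p, Submodule.subset_span hvD⟩ hvD
    rw [← hL, ← hL] at h
    simp only [map_sub] at h
    rw [map_add]
    linarith
  · have h := hl w hw
    rw [← hL, ← hL] at h
    rw [map_add, map_add]
    linarith

variable [InnerProductSpace ℝ E]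

lemma IsPolytope.isCompact {P : Set E} (hP : IsPolytope P) : IsCompact P := by
  obtain ⟨V, hV, -, rfl⟩ := hP
  exact hV.isCompact_convexHull ℝ

lemma IsPolytope.convex {P : Set E} (hP : IsPolytope P) : Convex ℝ P := by
  obtain ⟨V, -, -, rfl⟩ := hP
  exact convex_convexHull ℝ V

lemma IsPolytope.finite_extremePoints {P : Set E} (hP : IsPolytope P) :
    (P.extremePoints ℝ).Finite := by
  obtain ⟨V, hV, -, rfl⟩ := hP
  exact hV.subset extremePoints_convexHull_subset

lemma IsPolytope.finite_extremePoints_of_isExposed {P f : Set E} (hP : IsPolytope P)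
    (hf : IsExposed ℝ P f) : (f.extremePoints ℝ).Finite :=
  hP.finite_extremePoints.subset hf.isExtreme.extremePoints_subset_extremePoints

lemma IsPolytope.convexHull_extremePoints_of_isExposed {P f : Set E} (hP : IsPolytope P)
    (hf : IsExposed ℝ P f) : convexHull ℝ (f.extremePoints ℝ) = f := by
  rw [← ((hP.finite_extremePoints_of_isExposed hf).isCompact_convexHull ℝ).isClosed.closure_eq]
  exact closure_convexHull_extremePoints (hf.isCompact hP.isCompact) (hf.convex hP.convex)

lemma compPoly_nonempty {P f : Set E} (hP : IsPolytope P) (hf : IsFaceOf P f) :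
    (compPoly P f).Nonempty := by
  rw [compPoly, convexHull_nonempty_iff, Set.sdiff_nonempty]
  intro h
  refine hf.2.2 (hf.1.subset.antisymm ?_)
  rw [← hP.convexHull_extremePoints_of_isExposed (IsExposed.refl P),
    ← hP.convexHull_extremePoints_of_isExposed hf.1]
  exact convexHull_mono h

/-- Exposed faces of an exposed face of a polytope are exposed faces of the polytope. -/
lemma IsPolytope.isExposed_trans {P f g : Set E} (hP : IsPolytope P) (hf : IsExposed ℝ P f)
    (hg : IsExposed ℝ f g) : IsExposed ℝ P g := by
  rintro ⟨q, hq⟩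
  have hqf := hg.subset hq
  obtain ⟨l, rfl⟩ := hf ⟨q, hqf⟩
  obtain ⟨k, rfl⟩ := hg ⟨q, hq⟩
  obtain ⟨V, hV, -, rfl⟩ := hP
  obtain ⟨N₀, hN₀⟩ := (hV.image fun v => |k v - k q| / (l q - l v)).bddAbove
  have hVN : ∀ v ∈ V, (max N₀ 0) * (l v - l q) + (k v - k q) ≤ 0 := by
    intro v hv
    have hvP := subset_convexHull ℝ V hv
    rcases (hqf.2 v hvP).lt_or_eq with h | h
    · have h1 : |k v - k q| / (l q - l v) ≤ max N₀ 0 :=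
        (hN₀ ⟨v, hv, rfl⟩).trans (le_max_left _ _)
      rw [div_le_iff₀ (by linarith)] at h1
      linarith [le_abs_self (k v - k q)]
    · have h1 : k v ≤ k q := hq.2 v ⟨hvP, fun y hy => h ▸ hqf.2 y hy⟩
      rw [h]
      linarith
  set N := max N₀ 0
  have hPN : ∀ v ∈ convexHull ℝ V, N * (l v - l q) + (k v - k q) ≤ 0 := by
    intro v hv
    have hsub : convexHull ℝ V ⊆ {v | (N • l + k) v ≤ (N • l + k) q} :=
      convexHull_min (fun v hv => by
        have := hVN v hv
        simp only [Set.mem_ofPred_eq, add_apply, smul_apply,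
          smul_eq_mul]
        linarith) (convex_halfSpace_le (N • l + k).isLinear _)
    have := hsub hv
    simp only [Set.mem_ofPred_eq, add_apply, smul_apply,
      smul_eq_mul] at this
    linarith
  refine ⟨(N + 1) • l + k, ?_⟩
  ext v
  simp only [Set.mem_ofPred_eq, add_apply, smul_apply,
    smul_eq_mul]
  constructor
  · rintro ⟨⟨hv, hlv⟩, hkv⟩
    refine ⟨hv, fun y hy => ?_⟩
    have h1 := hPN y hy
    have h2 := hqf.2 y hy
    have h3 := hkv q hqf
    have h4 : l v = l q := le_antisymm (hqf.2 v hv) (hlv q hqf.1)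
    rw [h4]
    linarith
  · rintro ⟨hv, hmax⟩
    have h1 := hPN v hv
    have h2 := hqf.2 v hv
    have h3 := hmax q hqf.1
    have h4 : l v = l q := by linarith
    rw [h4] at h3
    exact ⟨⟨hv, fun y hy => h4 ▸ hqf.2 y hy⟩, fun y hy => (hq.2 y hy).trans (by linarith)⟩

/-- A point of the affine span of a face `f` outside `f` lies beyond the affine span of a proper
subface `g`, as seen from a point of the complementary polytope of `g` in `f`. -/
lemma exists_subface_beyond [FiniteDimensional ℝ E] {P f : Set E} (hP : IsPolytope P)
    (hf : IsFaceOf P f) {x : E} (hx : x ∈ affineSpan ℝ f) (hxf : x ∉ f) :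
    ∃ g : Set E, IsFaceOf P g ∧ g.extremePoints ℝ ⊂ f.extremePoints ℝ ∧
      ∃ z ∈ affineSpan ℝ g, ∃ b ∈ compPoly f g, z ∈ segment ℝ b x := by
  have hfc := hf.1.isCompact hP.isCompact
  obtain ⟨l, z, w, hz, hw, ⟨r, s, hr, hs, hrs, hzw⟩, hmax, hlw⟩ :=
    exists_supporting_functional_of_mem_affineSpan (hf.1.convex hP.convex) hfc.isClosed hf.2.1
      hx hxf
  set g : Set E := {v ∈ f | ∀ y ∈ f, l y ≤ l v}
  have hgf : IsExposed ℝ f g := fun _ => ⟨l, rfl⟩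
  have hgP := hP.isExposed_trans hf.1 hgf
  have hzg : z ∈ g := ⟨hz, hmax⟩
  have hwg : w ∉ g := fun h => (h.2 z hz).not_gt hlw
  have hgconv := hP.convexHull_extremePoints_of_isExposed hgP
  have hfconv := hP.convexHull_extremePoints_of_isExposed hf.1
  have hsub : g.extremePoints ℝ ⊆ f.extremePoints ℝ :=
    hgf.isExtreme.extremePoints_subset_extremePoints
  have hnsub : ¬ f.extremePoints ℝ ⊆ g.extremePoints ℝ := by
    intro h
    refine hwg ?_
    rw [← hgconv]
    exact convexHull_mono h (hfconv.symm ▸ hw)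
  have hgne : (g.extremePoints ℝ).Nonempty := by
    rw [← convexHull_nonempty_iff (𝕜 := ℝ), hgconv]
    exact ⟨z, hzg⟩
  refine ⟨g, ⟨hgP, ⟨z, hzg⟩, ?_⟩, ⟨hsub, hnsub⟩, ?_⟩
  · intro h
    exact hwg (h ▸ hf.1.subset hw)
  have hw' : w ∈ convexHull ℝ (g.extremePoints ℝ ∪ (f.extremePoints ℝ \ g.extremePoints ℝ)) := by
    rwa [Set.union_sdiff_cancel hsub, hfconv]
  rw [convexHull_union hgne (Set.sdiff_nonempty.2 hnsub), mem_convexJoin] at hw'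
  obtain ⟨a, ha, b, hb, α, β, hα, hβ, hαβ, hab⟩ := hw'
  rw [hgconv] at ha
  have hc : 0 < 1 - r * α := by
    by_contra hcon
    have hr1 : r ≤ 1 := by linarith
    have hα1 : α ≤ 1 := by linarith
    have hα' : α = 1 := by nlinarith
    have hβ' : β = 0 := by linarith
    rw [hα', hβ', one_smul, zero_smul, add_zero] at hab
    exact hwg (hab ▸ ha)
  set c := 1 - r * α with hcdef
  refine ⟨AffineMap.lineMap a z (c⁻¹), AffineMap.lineMap_mem _ (subset_affineSpan ℝ g ha)
    (subset_affineSpan ℝ g hzg), b, hb, r * β / c, s / c, by positivity, by positivity, ?_, ?_⟩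
  · rw [← add_div, div_eq_one_iff_eq hc.ne']
    rw [hcdef, ← hrs]
    have : β = 1 - α := by linarith
    rw [this]
    linarith
  · have hz' : z = r • (α • a + β • b) + s • x := by rw [hab, hzw]
    have h1 : c • ((r * β / c) • b + (s / c) • x) = (r * β) • b + s • x := by
      rw [smul_add, smul_smul, smul_smul, mul_div_cancel₀ _ hc.ne', mul_div_cancel₀ _ hc.ne']
    have h2 : c • AffineMap.lineMap a z c⁻¹ = z - a + c • a := by
      rw [AffineMap.lineMap_apply, vsub_eq_sub, vadd_eq_add, smul_add, smul_smul,
        mul_inv_cancel₀ hc.ne', one_smul]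
    refine smul_right_injective E hc.ne' ?_
    simp only
    rw [h1, h2, hz', hcdef]
    module

/-- Every distance between a point of the affine span of a face and its complementary polytope
dominates a distance between a face and its complementary polytope. -/
lemma exists_face_dist_le [FiniteDimensional ℝ E] {P f : Set E} (hP : IsPolytope P)
    (hf : IsFaceOf P f) {x y : E} (hx : x ∈ affineSpan ℝ f) (hy : y ∈ compPoly P f) :
    ∃ g : Set E, IsFaceOf P g ∧ setDist g (compPoly P g) ≤ dist x y := by
  induction hn : (f.extremePoints ℝ).ncard using Nat.strong_induction_on generalizing f x y with
  | _ n ih =>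
    by_cases hxf : x ∈ f
    · exact ⟨f, hf, setDist_le_dist hxf hy⟩
    obtain ⟨g, hg, hgf, z, hz, b, hb, r, s, hr, hs, hrs, rfl⟩ := exists_subface_beyond hP hf hx hxf
    have hbg : b ∈ compPoly P g := convexHull_mono
      (Set.sdiff_subset_sdiff_left hf.1.isExtreme.extremePoints_subset_extremePoints) hb
    have hyg : y ∈ compPoly P g := convexHull_mono (Set.sdiff_subset_sdiff_right hgf.subset) hy
    obtain ⟨g', hg', hle⟩ := ih _
      (hn ▸ Set.ncard_lt_ncard hgf (hP.finite_extremePoints_of_isExposed hf.1)) hg hz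
      (convex_convexHull ℝ _ hbg hyg hr hs hrs) rfl
    refine ⟨g', hg', hle.trans ?_⟩
    rw [dist_add_left, dist_smul₀, Real.norm_of_nonneg hs]
    exact mul_le_of_le_one_left dist_nonneg (by linarith)

end Faces

/-- For every polytope with at least two vertices, the pyramidal width equals the affine
pyramidal width. -/
theorem pyramidalWidth_eq_affPyramidalWidth
    {E : Type*} [NormedAddCommGroup E] [InnerProductSpace ℝ E] [FiniteDimensional ℝ E]
    (P : Set E) (hP : IsPolytope P) (hv : (P.extremePoints ℝ).Nontrivial) :
    pyramidalWidth P = affPyramidalWidth P := by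
  have hbdd (F : Set E → Set E) :
      BddBelow {d : ℝ | ∃ f : Set E, IsFaceOf P f ∧ d = setDist (F f) (compPoly P f)} := by
    refine ⟨0, ?_⟩
    rintro _ ⟨f, -, rfl⟩
    exact Real.sInf_nonneg (by rintro _ ⟨p, -, rfl⟩; exact dist_nonneg)
  by_cases hface : ∃ f, IsFaceOf P f
  · obtain ⟨f₀, hf₀⟩ := hface
    refine le_antisymm (le_csInf ⟨_, f₀, hf₀, rfl⟩ ?_) (le_csInf ⟨_, f₀, hf₀, rfl⟩ ?_)
    · rintro _ ⟨f, hf, rfl⟩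
      refine le_setDist (hf.2.1.mono (subset_affineSpan ℝ f)) (compPoly_nonempty hP hf) ?_
      intro x hx y hy
      obtain ⟨g, hg, hle⟩ := exists_face_dist_le hP hf hx hy
      exact (csInf_le (hbdd id) ⟨g, hg, rfl⟩).trans hle
    · rintro _ ⟨f, hf, rfl⟩
      refine (csInf_le (hbdd fun f => affineSpan ℝ f) ⟨f, hf, rfl⟩).trans ?_
      exact le_setDist hf.2.1 (compPoly_nonempty hP hf) fun a ha b hb =>
        setDist_le_dist (subset_affineSpan ℝ f ha) hb
  · have hempty : ∀ f, ¬ IsFaceOf P f := not_exists.1 hface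
    simp [pyramidalWidth, affPyramidalWidth, hempty]
end

section
/- Let P₁, …, P_k (k ≥ 2) be polytopes of dimension at least 1 in finite-dimensional real inner product spaces, and let P = P₁ × ⋯ × P_k carry the ℓ² product norm. Then the vertex-facet distance of the product equals the minimum of the individual vertex-facet distances: vf(P) = minᵢ vf(Pᵢ). -/
section Defs

variable {E : Type*} [NormedAddCommGroup E] [InnerProductSpace ℝ E]

/-- The dimension of a set: the rank of the direction of its affine span. -/
noncomputable def setDim (S : Set E) : ℕ :=
  Module.finrank ℝ (affineSpan ℝ S).direction

/-- A facet of `P`: a nonempty proper exposed face of dimension `dim(P) − 1`. -/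
def IsFacetOf (P F : Set E) : Prop :=
  IsExposed ℝ P F ∧ F.Nonempty ∧ F ≠ P ∧ setDim F + 1 = setDim P

/-- The inner vertex-facet distance `vf(P, F) = dist(aff(F), V(P) \ V(F))`, where `V(·)`
denotes the set of extreme points. -/
noncomputable def innerVertexFacetDist (P F : Set E) : ℝ :=
  setDist (affineSpan ℝ F : Set E) (P.extremePoints ℝ \ F.extremePoints ℝ)

end Defs

/-- The vertex-facet distance `vf(P) = min over facets F of P of dist(aff(F), V(P) \ V(F))`. -/
noncomputable def vertexFacetDist {E : Type*} [NormedAddCommGroup E] [InnerProductSpace ℝ E]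
    (P : Set E) : ℝ :=
  sInf {d : ℝ | ∃ F : Set E, IsFacetOf P F ∧ d = innerVertexFacetDist P F}

section VertexFacetAux

open Module

section Single

variable {E : Type*} [NormedAddCommGroup E] [InnerProductSpace ℝ E]

lemma setDist_nonneg {X : Type*} [PseudoMetricSpace X] (A B : Set X) : 0 ≤ setDist A B := by
  apply Real.sInf_nonneg
  rintro _ ⟨p, -, rfl⟩
  exact dist_nonneg

lemma bddBelow_image_dist {X : Type*} [PseudoMetricSpace X] (T : Set (X × X)) :
    BddBelow ((fun p : X × X => dist p.1 p.2) '' T) := by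
  refine ⟨0, ?_⟩
  rintro _ ⟨p, -, rfl⟩
  exact dist_nonneg

lemma bddBelow_facetDists (S : Set E) :
    BddBelow {d : ℝ | ∃ F : Set E, IsFacetOf S F ∧ d = innerVertexFacetDist S F} := by
  refine ⟨0, ?_⟩
  rintro _ ⟨F, -, rfl⟩
  exact setDist_nonneg _ _

lemma setDim_eq_finrank_vectorSpan (S : Set E) : setDim S = finrank ℝ (vectorSpan ℝ S) := by
  rw [setDim, direction_affineSpan]

lemma mem_affineSpan_iff_sub_mem_vectorSpan {S : Set E} {p : E} (hp : p ∈ S) (x : E) :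
    x ∈ affineSpan ℝ S ↔ x - p ∈ vectorSpan ℝ S := by
  rw [← direction_affineSpan, ← vsub_eq_sub,
    AffineSubspace.vsub_right_mem_direction_iff_mem (mem_affineSpan ℝ hp)]

lemma vectorSpan_le_ker_of_forall_eq {S : Set E} (l : E →ₗ[ℝ] ℝ)
    (h : ∀ x ∈ S, ∀ y ∈ S, l x = l y) : vectorSpan ℝ S ≤ LinearMap.ker l := by
  rw [vectorSpan, Submodule.span_le]
  rintro _ ⟨x, hx, y, hy, rfl⟩
  simp [h x hx y hy]

lemma IsPolytope.nonempty {S : Set E} (hS : IsPolytope S) : S.Nonempty := by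
  obtain ⟨V, -, hne, rfl⟩ := hS
  exact hne.convexHull

lemma IsPolytope.extremePoints_nonempty {S : Set E} (hS : IsPolytope S) :
    (S.extremePoints ℝ).Nonempty := by
  obtain ⟨V, hV, hne, rfl⟩ := hS
  exact (hV.isCompact_convexHull ℝ).extremePoints_nonempty hne.convexHull

/-- The set of points of `S` at which `l` is maximal. -/
def maximalFace (S : Set E) (l : StrongDual ℝ E) : Set E := {x ∈ S | ∀ y ∈ S, l y ≤ l x}

lemma maximalFace_subset (S : Set E) (l : StrongDual ℝ E) : maximalFace S l ⊆ S := fun _ h => h.1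

lemma vectorSpan_maximalFace_le_ker (S : Set E) (l : StrongDual ℝ E) :
    vectorSpan ℝ (maximalFace S l) ≤ LinearMap.ker (l : E →ₗ[ℝ] ℝ) :=
  vectorSpan_le_ker_of_forall_eq _ fun x hx y hy => le_antisymm (hy.2 x hx.1) (hx.2 y hy.1)

variable [FiniteDimensional ℝ E]

lemma setDim_mono {S T : Set E} (h : S ⊆ T) : setDim S ≤ setDim T := by
  simp only [setDim_eq_finrank_vectorSpan]
  exact Submodule.finrank_mono (vectorSpan_mono ℝ h)

lemma maximalFace_eq_of_setDim_eq {S : Set E} {l : StrongDual ℝ E}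
    (hne : (maximalFace S l).Nonempty) (hdim : setDim (maximalFace S l) = setDim S) :
    maximalFace S l = S := by
  obtain ⟨p, hp⟩ := hne
  simp only [setDim_eq_finrank_vectorSpan] at hdim
  have heq := Submodule.eq_of_le_of_finrank_eq
    (vectorSpan_mono ℝ (maximalFace_subset S l)) hdim
  refine (maximalFace_subset S l).antisymm fun x hx => ⟨hx, fun y hy => ?_⟩
  have hxp : x - p ∈ vectorSpan ℝ S := vsub_mem_vectorSpan ℝ hx hp.1
  rw [← heq] at hxp
  have h0 := vectorSpan_maximalFace_le_ker S l hxp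
  simp only [LinearMap.mem_ker, ContinuousLinearMap.coe_coe, map_sub] at h0
  linarith [hp.2 y hy]

open scoped RealInnerProductSpace

lemma finrank_vectorSpan_lt_of_inner_eq {S : Set E} {W : Submodule ℝ E} {u : E}
    (hSW : vectorSpan ℝ S ≤ W) (huW : u ∈ W) (hu : u ≠ 0)
    (h : ∀ x ∈ S, ∀ y ∈ S, ⟪u, x⟫ = ⟪u, y⟫) :
    finrank ℝ (vectorSpan ℝ S) < finrank ℝ W := by
  apply Submodule.finrank_lt_finrank_of_lt
  refine lt_of_le_of_ne hSW fun heq => hu ?_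
  have := vectorSpan_le_ker_of_forall_eq (innerSL ℝ u : E →ₗ[ℝ] ℝ) h (heq ▸ huW)
  simpa using this

/-- Rotating a supporting hyperplane of a finite set about the points it touches, if these span
a space of codimension at least two, makes it touch a set of larger dimension. -/
lemma exists_supporting_inner_finrank_lt {V : Set E} (hV : V.Finite) {u : E} {c : ℝ}
    (huW : u ∈ vectorSpan ℝ V) (hu : u ≠ 0) (hc : ∀ v ∈ V, ⟪u, v⟫ ≤ c)
    (hT : ∃ v ∈ V, ⟪u, v⟫ = c)
    (hlt : finrank ℝ (vectorSpan ℝ {v ∈ V | ⟪u, v⟫ = c}) + 1 < finrank ℝ (vectorSpan ℝ V)) :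
    ∃ u' ∈ vectorSpan ℝ V, u' ≠ 0 ∧ ∃ c', (∀ v ∈ V, ⟪u', v⟫ ≤ c') ∧ (∃ v ∈ V, ⟪u', v⟫ = c') ∧
      finrank ℝ (vectorSpan ℝ {v ∈ V | ⟪u, v⟫ = c}) <
        finrank ℝ (vectorSpan ℝ {v ∈ V | ⟪u', v⟫ = c'}) := by
  set W := vectorSpan ℝ V
  set D := vectorSpan ℝ {v ∈ V | ⟪u, v⟫ = c}
  obtain ⟨p, hpV, hpc⟩ := hT
  have hDW : D ≤ W := vectorSpan_mono ℝ fun v hv => hv.1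
  have hlt' : D ⊔ Submodule.span ℝ {u} < W := by
    refine lt_of_le_of_ne (sup_le hDW ?_) fun h => ?_
    · simpa [Submodule.span_le] using huW
    · have h1 := Submodule.finrank_add_le_finrank_add_finrank D (Submodule.span ℝ {u})
      rw [h, finrank_span_singleton hu] at h1
      omega
  obtain ⟨w, ⟨hwort, hwW⟩, hw0⟩ : ∃ w ∈ (D ⊔ Submodule.span ℝ {u})ᗮ ⊓ W, w ≠ 0 := by
    apply Submodule.exists_mem_ne_zero_of_ne_bot
    intro h
    have := Submodule.sup_orthogonal_inf_of_hasOrthogonalProjection hlt'.le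
    rw [h, sup_bot_eq] at this
    exact hlt'.ne this
  rw [SetLike.mem_coe, Submodule.mem_orthogonal] at hwort
  have hwu : ⟪u, w⟫ = 0 := hwort u (Submodule.mem_sup_right (Submodule.mem_span_singleton_self u))
  have hwD : ∀ v ∈ V, ⟪u, v⟫ = c → ⟪w, v⟫ = ⟪w, p⟫ := by
    intro v hv hvc
    have h1 : v - p ∈ D := vsub_mem_vectorSpan ℝ ⟨hv, hvc⟩ ⟨hpV, hpc⟩
    have h2 := hwort _ (Submodule.mem_sup_left h1)
    rw [real_inner_comm, inner_sub_right] at h2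
    linarith
  obtain ⟨m, hmW, hmu, hmD, q, hqV, hq⟩ : ∃ m ∈ W, ⟪u, m⟫ = 0 ∧
      (∀ v ∈ V, ⟪u, v⟫ = c → ⟪m, v⟫ = ⟪m, p⟫) ∧ ∃ q ∈ V, ⟪m, p⟫ < ⟪m, q⟫ := by
    obtain ⟨q, hqV, hq⟩ : ∃ q ∈ V, ⟪w, q⟫ ≠ ⟪w, p⟫ := by
      by_contra! h
      exact lt_irrefl _ (finrank_vectorSpan_lt_of_inner_eq (S := V) le_rfl hwW hw0
        fun x hx y hy => (h x hx).trans (h y hy).symm)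
    rcases lt_or_gt_of_ne hq with h | h
    · refine ⟨-w, W.neg_mem hwW, by simp [hwu], fun v hv hvc => ?_, q, hqV, ?_⟩
      · simp [hwD v hv hvc]
      · simpa using h
    · exact ⟨w, hwW, hwu, hwD, q, hqV, h⟩
  obtain ⟨z, ⟨hzV, hzp⟩, hzmin⟩ := Set.exists_min_image {v ∈ V | ⟪m, p⟫ < ⟪m, v⟫}
    (fun v => (c - ⟪u, v⟫) / (⟪m, v⟫ - ⟪m, p⟫)) (hV.subset fun v hv => hv.1) ⟨q, hqV, hq⟩
  have hzc : ⟪u, z⟫ < c := lt_of_le_of_ne (hc z hzV) fun h => hzp.ne' (hmD z hzV h)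
  set t := (c - ⟪u, z⟫) / (⟪m, z⟫ - ⟪m, p⟫)
  have htpos : 0 < t := div_pos (by linarith) (by linarith)
  have hu' : ∀ v, ⟪u + t • m, v⟫ = ⟪u, v⟫ + t * ⟪m, v⟫ := fun v => by
    rw [inner_add_left, real_inner_smul_left]
  have hTT : ∀ v ∈ V, ⟪u, v⟫ = c → ⟪u + t • m, v⟫ = c + t * ⟪m, p⟫ := by
    intro v hv hvc
    rw [hu', hvc, hmD v hv hvc]
  have hzT : ⟪u + t • m, z⟫ = c + t * ⟪m, p⟫ := by
    have : t * (⟪m, z⟫ - ⟪m, p⟫) = c - ⟪u, z⟫ := div_mul_cancel₀ _ (by linarith)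
    rw [hu']
    linarith
  refine ⟨u + t • m, W.add_mem huW (W.smul_mem t hmW), fun h => ?_, c + t * ⟪m, p⟫,
    fun v hv => ?_, ⟨p, hpV, hTT p hpV hpc⟩, ?_⟩
  · have h1 : ⟪u, u + t • m⟫ = 0 := by rw [h, inner_zero_right]
    rw [inner_add_right, real_inner_smul_right, hmu, mul_zero, add_zero] at h1
    exact hu (inner_self_eq_zero.mp h1)
  · rw [hu']
    rcases le_or_gt ⟪m, v⟫ ⟪m, p⟫ with h | h
    · have := mul_le_mul_of_nonneg_left h htpos.le
      linarith [hc v hv]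
    · have h1 := hzmin v ⟨hv, h⟩
      have h2 := (le_div_iff₀ (sub_pos.mpr h)).mp h1
      linarith
  · apply Submodule.finrank_lt_finrank_of_lt
    refine lt_of_le_of_ne (vectorSpan_mono ℝ fun v hv => ⟨hv.1, hTT v hv.1 hv.2⟩) fun h => ?_
    have h1 : z - p ∈ D := by
      rw [h]
      exact vsub_mem_vectorSpan ℝ ⟨hzV, hzT⟩ ⟨hpV, hTT p hpV hpc⟩
    have h2 := vectorSpan_le_ker_of_forall_eq (innerSL ℝ u : E →ₗ[ℝ] ℝ)
      (fun x hx y hy => hx.2.trans hy.2.symm) h1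
    simp only [LinearMap.mem_ker, ContinuousLinearMap.coe_coe, innerSL_apply_apply,
      inner_sub_right] at h2
    linarith

lemma exists_supporting_inner_finrank_add_one {V : Set E} (hV : V.Finite)
    (hdim : vectorSpan ℝ V ≠ ⊥) :
    ∃ u ∈ vectorSpan ℝ V, u ≠ 0 ∧ ∃ c, (∀ v ∈ V, ⟪u, v⟫ ≤ c) ∧ (∃ v ∈ V, ⟪u, v⟫ = c) ∧
      finrank ℝ (vectorSpan ℝ {v ∈ V | ⟪u, v⟫ = c}) + 1 = finrank ℝ (vectorSpan ℝ V) := by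
  have key : ∀ n : ℕ, ∀ u ∈ vectorSpan ℝ V, u ≠ 0 → ∀ c, (∀ v ∈ V, ⟪u, v⟫ ≤ c) →
      (∃ v ∈ V, ⟪u, v⟫ = c) →
      finrank ℝ (vectorSpan ℝ V) ≤ finrank ℝ (vectorSpan ℝ {v ∈ V | ⟪u, v⟫ = c}) + 1 + n →
      ∃ u ∈ vectorSpan ℝ V, u ≠ 0 ∧ ∃ c, (∀ v ∈ V, ⟪u, v⟫ ≤ c) ∧ (∃ v ∈ V, ⟪u, v⟫ = c) ∧
        finrank ℝ (vectorSpan ℝ {v ∈ V | ⟪u, v⟫ = c}) + 1 = finrank ℝ (vectorSpan ℝ V) := by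
    intro n
    induction n with
    | zero =>
      intro u huW hu c hc hT hle
      have hlt := finrank_vectorSpan_lt_of_inner_eq (S := {v ∈ V | ⟪u, v⟫ = c})
        (vectorSpan_mono ℝ fun v hv => hv.1) huW hu fun x hx y hy => hx.2.trans hy.2.symm
      exact ⟨u, huW, hu, c, hc, hT, by omega⟩
    | succ n ih =>
      intro u huW hu c hc hT hle
      rcases lt_or_ge (finrank ℝ (vectorSpan ℝ {v ∈ V | ⟪u, v⟫ = c}) + 1)
        (finrank ℝ (vectorSpan ℝ V)) with hlt | hge
      · obtain ⟨u', hu'W, hu', c', hc', hT', h⟩ :=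
          exists_supporting_inner_finrank_lt hV huW hu hc hT hlt
        exact ih u' hu'W hu' c' hc' hT' (by omega)
      · exact ih u huW hu c hc hT (by omega)
  obtain ⟨u, huW, hu⟩ := Submodule.exists_mem_ne_zero_of_ne_bot hdim
  have hne : V.Nonempty := by
    by_contra h
    exact hdim (by rw [Set.not_nonempty_iff_eq_empty.mp h, vectorSpan_empty])
  obtain ⟨p, hp, hmax⟩ := Set.exists_max_image V (fun v => ⟪u, v⟫) hV hne
  exact key _ u huW hu ⟪u, p⟫ hmax ⟨p, hp, rfl⟩ (Nat.le_add_left _ _)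

lemma IsPolytope.exists_isFacetOf {S : Set E} (hS : IsPolytope S) (hdim : 1 ≤ setDim S) :
    ∃ F, IsFacetOf S F := by
  obtain ⟨V, hV, -, rfl⟩ := hS
  have hspan : vectorSpan ℝ (convexHull ℝ V) = vectorSpan ℝ V := by
    rw [← direction_affineSpan, affineSpan_convexHull, direction_affineSpan]
  rw [setDim_eq_finrank_vectorSpan, hspan] at hdim
  obtain ⟨u, huW, hu, c, hc, ⟨p, hpV, hpc⟩, hfin⟩ :=
    exists_supporting_inner_finrank_add_one hV fun h => by simp [h] at hdim
  have hcS : ∀ x ∈ convexHull ℝ V, ⟪u, x⟫ ≤ c :=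
    convexHull_min hc (convex_halfSpace_le (innerSL ℝ u : E →ₗ[ℝ] ℝ).isLinear c)
  have hTF : {v ∈ V | ⟪u, v⟫ = c} ⊆ maximalFace (convexHull ℝ V) (innerSL ℝ u) := fun v hv =>
    ⟨subset_convexHull ℝ V hv.1, fun y hy => by simpa [hv.2] using hcS y hy⟩
  have hge := setDim_mono hTF
  have hlt := finrank_vectorSpan_lt_of_inner_eq
    (S := maximalFace (convexHull ℝ V) (innerSL ℝ u))
    (hspan ▸ vectorSpan_mono ℝ (maximalFace_subset _ _)) huW hu
    fun x hx y hy => le_antisymm (hy.2 x hx.1) (hx.2 y hy.1)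
  have hdimF : setDim (maximalFace (convexHull ℝ V) (innerSL ℝ u)) + 1 =
      setDim (convexHull ℝ V) := by
    simp only [setDim_eq_finrank_vectorSpan] at hge ⊢
    rw [hspan]
    omega
  refine ⟨maximalFace (convexHull ℝ V) (innerSL ℝ u), fun _ => ⟨innerSL ℝ u, rfl⟩,
    ⟨p, hTF ⟨hpV, hpc⟩⟩, fun h => ?_, hdimF⟩
  rw [h] at hdimF
  omega

end Single

section Product

variable {ι : Type*} {E : ι → Type*}

/-- The product of a family of sets, inside the ℓ² product. -/
def l2Prod (S : ∀ i, Set (E i)) : Set (PiLp 2 E) := {x | ∀ i, x i ∈ S i}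

lemma l2Prod_nonempty_iff {S : ∀ i, Set (E i)} : (l2Prod S).Nonempty ↔ ∀ i, (S i).Nonempty := by
  refine ⟨fun ⟨x, hx⟩ i => ⟨x i, hx i⟩, fun h => ?_⟩
  choose p hp using h
  exact ⟨WithLp.toLp 2 p, hp⟩

open Classical in
/-- Replace the coordinate of index `i` of `x` by `a`. -/
noncomputable def l2Update (x : PiLp 2 E) (i : ι) (a : E i) : PiLp 2 E :=
  WithLp.toLp 2 (Function.update x.ofLp i a)

@[simp]
lemma l2Update_same (x : PiLp 2 E) (i : ι) (a : E i) : l2Update x i a i = a := by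
  simp [l2Update]

@[simp]
lemma l2Update_of_ne (x : PiLp 2 E) {i j : ι} (h : j ≠ i) (a : E i) : l2Update x i a j = x j := by
  simp [l2Update, h]

lemma l2Update_mem {S : ∀ i, Set (E i)} {x : PiLp 2 E} {i : ι} (hx : ∀ j ≠ i, x j ∈ S j)
    {a : E i} (ha : a ∈ S i) : l2Update x i a ∈ l2Prod S := by
  intro j
  by_cases h : j = i
  · subst h
    simpa using ha
  · simpa [h] using hx j h

lemma l2Update_eq_self (x : PiLp 2 E) (i : ι) : l2Update x i (x i) = x := by
  ext j
  by_cases h : j = i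
  · subst h
    simp
  · simp [h]

open Classical in
lemma l2Prod_update_eq {S : ∀ i, Set (E i)} {i : ι} {F : Set (E i)} (hF : F ⊆ S i) :
    l2Prod (Function.update S i F) = {x ∈ l2Prod S | x i ∈ F} := by
  ext x
  simp only [l2Prod, Set.mem_ofPred_eq]
  refine ⟨fun h => ⟨fun j => ?_, by simpa using h i⟩, fun h j => ?_⟩
  · by_cases hj : j = i
    · subst hj
      exact hF (by simpa using h j)
    · simpa [hj] using h j
  · by_cases hj : j = i
    · subst hj
      simpa using h.2
    · simpa [hj] using h.1 j

variable [∀ i, NormedAddCommGroup (E i)]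

open Classical in
lemma l2Update_sub_l2Update (x : PiLp 2 E) (i : ι) (a b : E i) :
    l2Update x i a - l2Update x i b = PiLp.single 2 i (a - b) := by
  ext j
  by_cases h : j = i
  · subst h
    simp
  · simp [h]

lemma extremePoints_l2Prod [∀ i, InnerProductSpace ℝ (E i)]
    (S : ∀ i, Set (E i)) :
    (l2Prod S).extremePoints ℝ = l2Prod fun i => (S i).extremePoints ℝ := by
  have h (T : ∀ i, Set (E i)) : l2Prod T = (WithLp.linearEquiv 2 ℝ (∀ i, E i)).symm ''
      Set.univ.pi T := by
    ext x
    rw [LinearEquiv.image_symm_eq_preimage]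
    simp [l2Prod]
  rw [h, h, ← image_extremePoints, extremePoints_pi]

variable [Fintype ι]

lemma dist_l2Update_left (x : PiLp 2 E) (i : ι) (a : E i) :
    dist (l2Update x i a) x = dist a (x i) := by
  classical
  have h := l2Update_sub_l2Update x i a (x i)
  rw [l2Update_eq_self] at h
  rw [dist_eq_norm, dist_eq_norm, h, PiLp.norm_single]

open Classical in
lemma sum_piLp_single (x : PiLp 2 E) : ∑ i, PiLp.single 2 i (x i) = x := by
  ext j
  simp [Finset.sum_apply]

variable [∀ i, InnerProductSpace ℝ (E i)]

lemma mem_vectorSpan_l2Prod {S : ∀ i, Set (E i)} (hS : ∀ i, (S i).Nonempty) (x : PiLp 2 E) :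
    x ∈ vectorSpan ℝ (l2Prod S) ↔ ∀ i, x i ∈ vectorSpan ℝ (S i) := by
  classical
  constructor
  · intro hx i
    have hle : vectorSpan ℝ (l2Prod S) ≤ (vectorSpan ℝ (S i)).comap (PiLp.projₗ 2 E i) := by
      rw [vectorSpan, Submodule.span_le]
      rintro _ ⟨y, hy, z, hz, rfl⟩
      exact vsub_mem_vectorSpan ℝ (hy i) (hz i)
    exact hle hx
  · intro hx
    obtain ⟨p, hp⟩ := l2Prod_nonempty_iff.mpr hS
    rw [← sum_piLp_single x]
    refine Submodule.sum_mem _ fun i _ => ?_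
    have hle : vectorSpan ℝ (S i) ≤ (vectorSpan ℝ (l2Prod S)).comap
        ((WithLp.linearEquiv 2 ℝ (∀ i, E i)).symm ∘ₗ LinearMap.single ℝ E i) := by
      rw [vectorSpan, Submodule.span_le]
      rintro _ ⟨y, hy, z, hz, rfl⟩
      have := vsub_mem_vectorSpan ℝ (l2Update_mem (fun j _ => hp j) hy)
        (l2Update_mem (fun j _ => hp j) hz)
      rwa [vsub_eq_sub, l2Update_sub_l2Update] at this
    exact hle (hx i)

lemma mem_affineSpan_l2Prod {S : ∀ i, Set (E i)} (hS : ∀ i, (S i).Nonempty) (x : PiLp 2 E) :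
    x ∈ affineSpan ℝ (l2Prod S) ↔ ∀ i, x i ∈ affineSpan ℝ (S i) := by
  obtain ⟨p, hp⟩ := l2Prod_nonempty_iff.mpr hS
  rw [mem_affineSpan_iff_sub_mem_vectorSpan hp, mem_vectorSpan_l2Prod hS]
  exact forall_congr' fun i => (mem_affineSpan_iff_sub_mem_vectorSpan (hp i) (x i)).symm

/-- A linear form on the ℓ² product is maximal over a product exactly where each of its
restrictions to a factor is maximal. -/
lemma exists_maximalFace_l2Prod_eq (S : ∀ i, Set (E i)) (l : StrongDual ℝ (PiLp 2 E)) :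
    ∃ m : ∀ i, StrongDual ℝ (E i),
      maximalFace (l2Prod S) l = l2Prod fun i => maximalFace (S i) (m i) := by
  classical
  let m (i : ι) : StrongDual ℝ (E i) :=
    l ∘L (PiLp.continuousLinearEquiv 2 ℝ E).symm ∘L ContinuousLinearMap.single ℝ E i
  have hm (i : ι) (a : E i) : m i a = l (PiLp.single 2 i a) := rfl
  have hsum (x : PiLp 2 E) : l x = ∑ i, m i (x i) := by
    conv_lhs => rw [← sum_piLp_single x, map_sum]
    rfl
  refine ⟨m, Set.Subset.antisymm (fun x hx i => ⟨hx.1 i, fun y hy => ?_⟩) fun x hx =>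
    ⟨fun i => (hx i).1, fun y hy => ?_⟩⟩
  · have h1 := hx.2 _ (l2Update_mem (fun j _ => hx.1 j) hy)
    have h2 := l2Update_sub_l2Update x i y (x i)
    rw [l2Update_eq_self] at h2
    have h3 := congrArg l h2
    rw [map_sub, ← hm, map_sub] at h3
    linarith
  · rw [hsum, hsum]
    exact Finset.sum_le_sum fun i _ => (hx i).2 _ (hy i)

lemma maximalFace_l2Prod_comp_proj {S : ∀ i, Set (E i)} (hS : ∀ i, (S i).Nonempty) (i : ι)
    (l : StrongDual ℝ (E i)) :
    maximalFace (l2Prod S) (l ∘L PiLp.proj 2 E i) =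
      {x ∈ l2Prod S | x i ∈ maximalFace (S i) l} := by
  obtain ⟨p, hp⟩ := l2Prod_nonempty_iff.mpr hS
  ext x
  refine ⟨fun hx => ⟨hx.1, hx.1 i, fun y hy => ?_⟩, fun hx => ⟨hx.1, fun y hy => hx.2.2 _ (hy i)⟩⟩
  simpa using hx.2 _ (l2Update_mem (fun j _ => hp j) hy)

open Classical in
lemma innerVertexFacetDist_l2Prod_update {S : ∀ i, Set (E i)} (hS : ∀ i, (S i).Nonempty)
    (hext : ∀ i, ((S i).extremePoints ℝ).Nonempty) {i : ι} {F : Set (E i)} (hF : F.Nonempty) :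
    innerVertexFacetDist (l2Prod S) (l2Prod (Function.update S i F)) =
      innerVertexFacetDist (S i) F := by
  have hne : ∀ j, (Function.update S i F j).Nonempty := by
    intro j
    by_cases hj : j = i
    · subst hj
      simpa using hF
    · simpa [hj] using hS j
  have haff (x : PiLp 2 E) : x ∈ affineSpan ℝ (l2Prod (Function.update S i F)) ↔
      x i ∈ affineSpan ℝ F ∧ ∀ j ≠ i, x j ∈ affineSpan ℝ (S j) := by
    rw [mem_affineSpan_l2Prod hne]
    refine ⟨fun h => ⟨by simpa using h i, fun j hj => by simpa [hj] using h j⟩, fun h j => ?_⟩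
    by_cases hj : j = i
    · subst hj
      simpa using h.1
    · simpa [hj] using h.2 j hj
  have hvert (x : PiLp 2 E) : x ∈ (l2Prod S).extremePoints ℝ \
      (l2Prod (Function.update S i F)).extremePoints ℝ ↔
      (∀ j, x j ∈ (S j).extremePoints ℝ) ∧ x i ∉ F.extremePoints ℝ := by
    rw [extremePoints_l2Prod, extremePoints_l2Prod]
    refine and_congr_right fun hx => not_congr ⟨fun h => by simpa using h i, fun h j => ?_⟩
    by_cases hj : j = i
    · subst hj
      simpa using h
    · simpa [hj] using hx j
  obtain ⟨q, hq⟩ := l2Prod_nonempty_iff.mpr hext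
  have hsub : (fun p : E i × E i => dist p.1 p.2) '' ((affineSpan ℝ F : Set (E i)) ×ˢ
      ((S i).extremePoints ℝ \ F.extremePoints ℝ)) ⊆
      (fun p : PiLp 2 E × PiLp 2 E => dist p.1 p.2) ''
        ((affineSpan ℝ (l2Prod (Function.update S i F)) : Set (PiLp 2 E)) ×ˢ
        ((l2Prod S).extremePoints ℝ \ (l2Prod (Function.update S i F)).extremePoints ℝ)) := by
    rintro _ ⟨⟨a, v⟩, ⟨ha, hv⟩, rfl⟩
    refine ⟨(l2Update (l2Update q i v) i a, l2Update q i v), ⟨?_, ?_⟩, ?_⟩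
    · refine (haff _).mpr ⟨by simpa using ha, fun j hj => ?_⟩
      simpa [hj] using subset_affineSpan ℝ _ (hq j).1
    · exact (hvert _).mpr ⟨l2Update_mem (fun j _ => hq j) hv.1, by simpa using hv.2⟩
    · simp [dist_l2Update_left]
  have hdom : ∀ d ∈ (fun p : PiLp 2 E × PiLp 2 E => dist p.1 p.2) ''
        ((affineSpan ℝ (l2Prod (Function.update S i F)) : Set (PiLp 2 E)) ×ˢ
        ((l2Prod S).extremePoints ℝ \ (l2Prod (Function.update S i F)).extremePoints ℝ)),
      ∃ e ∈ (fun p : E i × E i => dist p.1 p.2) '' ((affineSpan ℝ F : Set (E i)) ×ˢ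
        ((S i).extremePoints ℝ \ F.extremePoints ℝ)), e ≤ d := by
    rintro _ ⟨⟨a, v⟩, ⟨ha, hv⟩, rfl⟩
    have hv' := (hvert v).mp hv
    refine ⟨_, ⟨(a i, v i), ⟨((haff a).mp ha).1, hv'.1 i, hv'.2⟩, rfl⟩, ?_⟩
    simp only [dist_eq_norm]
    exact PiLp.norm_apply_le (a - v) i
  unfold innerVertexFacetDist setDist
  rcases Set.eq_empty_or_nonempty ((fun p : E i × E i => dist p.1 p.2) ''
    ((affineSpan ℝ F : Set (E i)) ×ˢ ((S i).extremePoints ℝ \ F.extremePoints ℝ))) with h | h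
  · rw [h] at hdom ⊢
    congr 1
    exact Set.eq_empty_of_forall_notMem fun d hd => by simpa using hdom d hd
  · refine le_antisymm (csInf_le_csInf (bddBelow_image_dist _) h hsub)
      (le_csInf (h.mono hsub) fun d hd => ?_)
    obtain ⟨e, he, hed⟩ := hdom d hd
    exact (csInf_le (bddBelow_image_dist _) he).trans hed

variable [∀ i, FiniteDimensional ℝ (E i)]

lemma setDim_l2Prod {S : ∀ i, Set (E i)} (hS : ∀ i, (S i).Nonempty) :
    setDim (l2Prod S) = ∑ i, setDim (S i) := by
  simp only [setDim_eq_finrank_vectorSpan]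
  let e : vectorSpan ℝ (l2Prod S) ≃ₗ[ℝ] ∀ i, vectorSpan ℝ (S i) :=
    { toFun x i := ⟨x.1 i, (mem_vectorSpan_l2Prod hS x.1).mp x.2 i⟩
      invFun y := ⟨WithLp.toLp 2 fun i => (y i : E i),
        (mem_vectorSpan_l2Prod hS _).mpr fun i => (y i).2⟩
      map_add' _ _ := rfl
      map_smul' _ _ := rfl
      left_inv _ := rfl
      right_inv _ := rfl }
  rw [e.finrank_eq, Module.finrank_pi_fintype]

open Classical in
lemma IsFacetOf.l2Prod_update {S : ∀ i, Set (E i)} (hS : ∀ i, (S i).Nonempty) {i : ι}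
    {F : Set (E i)} (hF : IsFacetOf (S i) F) :
    IsFacetOf (l2Prod S) (l2Prod (Function.update S i F)) := by
  obtain ⟨hexp, hFne, -, hdim⟩ := hF
  obtain ⟨l, rfl⟩ : ∃ l, F = maximalFace (S i) l := hexp hFne
  have hne : ∀ j, (Function.update S i (maximalFace (S i) l) j).Nonempty := by
    intro j
    by_cases hj : j = i
    · subst hj
      simpa using hFne
    · simpa [hj] using hS j
  have hdim' : setDim (l2Prod (Function.update S i (maximalFace (S i) l))) + 1 =
      setDim (l2Prod S) := by
    rw [setDim_l2Prod hne, setDim_l2Prod hS, ← Finset.add_sum_erase _ _ (Finset.mem_univ i),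
      ← Finset.add_sum_erase _ _ (Finset.mem_univ i), ← hdim, Function.update_self,
      Finset.sum_congr rfl fun j hj => by rw [Function.update_of_ne (Finset.ne_of_mem_erase hj)]]
    ring
  refine ⟨fun _ => ⟨l ∘L PiLp.proj 2 E i, ?_⟩, l2Prod_nonempty_iff.mpr hne, fun h => ?_, hdim'⟩
  · rw [l2Prod_update_eq (maximalFace_subset _ _)]
    exact (maximalFace_l2Prod_comp_proj hS i l).symm
  · rw [h] at hdim'
    omega

open Classical in
lemma IsFacetOf.exists_eq_l2Prod_update {S : ∀ i, Set (E i)} {G : Set (PiLp 2 E)}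
    (hG : IsFacetOf (l2Prod S) G) :
    ∃ i, ∃ F, IsFacetOf (S i) F ∧ G = l2Prod (Function.update S i F) := by
  obtain ⟨hexp, hGne, -, hdim⟩ := hG
  obtain ⟨l, rfl⟩ : ∃ l, G = maximalFace (l2Prod S) l := hexp hGne
  obtain ⟨m, hm⟩ := exists_maximalFace_l2Prod_eq S l
  rw [hm] at hGne hdim ⊢
  have hne := l2Prod_nonempty_iff.mp hGne
  have hle (j : ι) : setDim (maximalFace (S j) (m j)) ≤ setDim (S j) :=
    setDim_mono (maximalFace_subset _ _)
  rw [setDim_l2Prod hne, setDim_l2Prod fun j => (hne j).mono (maximalFace_subset _ _)] at hdim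
  obtain ⟨i, -, hi⟩ := Finset.exists_lt_of_sum_lt (hdim ▸ Nat.lt_succ_self _ :
    ∑ j, setDim (maximalFace (S j) (m j)) < ∑ j, setDim (S j))
  rw [← Finset.add_sum_erase _ _ (Finset.mem_univ i),
    ← Finset.add_sum_erase _ _ (Finset.mem_univ i)] at hdim
  have hsum := Finset.sum_le_sum fun j (_ : j ∈ Finset.univ.erase i) => hle j
  have heq : ∀ j ∈ Finset.univ.erase i, setDim (maximalFace (S j) (m j)) = setDim (S j) :=
    (Finset.sum_eq_sum_iff_of_le fun j _ => hle j).mp (by omega)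
  refine ⟨i, maximalFace (S i) (m i), ⟨fun _ => ⟨m i, rfl⟩, hne i, fun h => ?_, by omega⟩, ?_⟩
  · rw [h] at hi
    exact lt_irrefl _ hi
  · congr 1
    ext1 j
    by_cases hj : j = i
    · subst hj
      simp
    · rw [Function.update_of_ne hj]
      exact maximalFace_eq_of_setDim_eq (hne j) (heq j (by simp [hj]))

end Product

end VertexFacetAux

/-- The vertex-facet distance of a `k`-fold product (`k ≥ 2`) of polytopes of dimension at
least `1`, with the ℓ² product norm, equals the minimum of the individual vertex-facet
distances: `vf(P) = minᵢ vf(Pᵢ)`. -/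
theorem vertexFacetDist_pi_prod
    (k : ℕ) (hk : 2 ≤ k) (E : Fin k → Type*)
    [∀ i, NormedAddCommGroup (E i)] [∀ i, InnerProductSpace ℝ (E i)]
    [∀ i, FiniteDimensional ℝ (E i)]
    (P : ∀ i, Set (E i)) (hP : ∀ i, IsPolytope (P i)) (hPdim : ∀ i, 1 ≤ setDim (P i)) :
    vertexFacetDist {x : PiLp 2 E | ∀ i, x i ∈ P i} = ⨅ i, vertexFacetDist (P i) := by
  have hne i := (hP i).nonempty
  have : Nonempty (Fin k) := ⟨⟨0, by omega⟩⟩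
  change vertexFacetDist (l2Prod P) = _
  have hmem (i : Fin k) (F : Set (E i)) (hF : IsFacetOf (P i) F) :
      innerVertexFacetDist (P i) F ∈
        {d : ℝ | ∃ G, IsFacetOf (l2Prod P) G ∧ d = innerVertexFacetDist (l2Prod P) G} :=
    ⟨_, hF.l2Prod_update hne, (innerVertexFacetDist_l2Prod_update hne
      (fun j => (hP j).extremePoints_nonempty) hF.2.1).symm⟩
  refine le_antisymm (le_ciInf fun i => ?_) ?_
  · obtain ⟨F, hF⟩ := (hP i).exists_isFacetOf (hPdim i)
    refine le_csInf ⟨_, F, hF, rfl⟩ ?_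
    rintro _ ⟨G, hG, rfl⟩
    exact csInf_le (bddBelow_facetDists _) (hmem i G hG)
  · obtain ⟨F, hF⟩ := (hP (Classical.arbitrary _)).exists_isFacetOf (hPdim _)
    refine le_csInf ⟨_, hmem _ F hF⟩ ?_
    rintro _ ⟨G, hG, rfl⟩
    obtain ⟨i, F, hF, rfl⟩ := hG.exists_eq_l2Prod_update
    rw [innerVertexFacetDist_l2Prod_update hne (fun j => (hP j).extremePoints_nonempty) hF.2.1]
    exact (ciInf_le (Set.finite_range _).bddBelow i).trans
      (csInf_le (bddBelow_facetDists _) ⟨F, hF, rfl⟩)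
end
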